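/- Let K be a valued field and C ⊆ K a finite nonempty set. The fibers of the map K → RV^C sending x to the tuple (rv(x − c))_{c ∈ C} are exactly: the singletons {c} for c ∈ C, and the balls 1-next to C, where a ball 1-next to C is a nonempty intersection ∩_{c∈C} B_c with each B_c of the form {x : rv(x − c) = ξ_c} for some nonzero ξ_c ∈ RV. In particular, these fibers partition K, and the fibers disjoint from C are exactly the maximal balls of K disjoint from C. -/

import Mathlib

/- `K` is a valued field: a field with a (Krull) valuation `v : K → Γ₀ = Γ ∪ {0}`,
written multiplicatively. -/
variable {K : Type*} [Field K] {Γ₀ : Type*} [LinearOrderedCommGroupWithZero Γ₀]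

/-- The relation defining the leading-term structure `RV_λ = K^×/(1+I) ∪ {0}` where
`I = {x : |x| < λ}` : two elements are identified iff both are `0` or they differ
multiplicatively by an element of `1 + I`. -/
def rvRel (v : Valuation K Γ₀) (lam : Γ₀) (x y : K) : Prop :=
  (x = 0 ∧ y = 0) ∨ ∃ u : K, v (u - 1) < lam ∧ y = x * u

/-- The leading term map `rv_λ : K → RV_λ`, extending the projection
`K^× → K^×/(1+I)` by `0 ↦ 0`. -/
def rv (v : Valuation K Γ₀) (lam : Γ₀) (x : K) : Quot (rvRel v lam) := Quot.mk _ x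

/-- A ball in the valued field `K`: an infinite proper subset `B` such that whenever
`x, x' ∈ B` and `|x - y| ≤ |x - x'|`, also `y ∈ B`. -/
def IsBall (v : Valuation K Γ₀) (B : Set K) : Prop :=
  B.Infinite ∧ B ≠ Set.univ ∧ ∀ x ∈ B, ∀ x' ∈ B, ∀ y : K, v (x - y) ≤ v (x - x') → y ∈ B

theorem rv_eq_rv_iff (v : Valuation K Γ₀) (x y : K) :
    rv v 1 x = rv v 1 y ↔ x = y ∨ v (x - y) < v y := by
  constructor
  · intro h
    induction Quot.eqvGen_exact h with
    | rel x y hxy =>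
      rcases hxy with ⟨rfl, rfl⟩ | ⟨u, hu, rfl⟩
      · exact Or.inl rfl
      · by_cases hx : x = 0
        · simp [hx]
        · right
          have hu1 : v u = 1 := by
            simpa using v.map_one_add_of_lt hu
          have hx' : 0 < v x := v.pos_iff.mpr hx
          rw [v.map_sub_swap, show x * u - x = x * (u - 1) by ring, map_mul, map_mul, hu1]
          exact mul_lt_mul_of_pos_left hu hx'
    | refl x => exact Or.inl rfl
    | symm x y _ ih =>
      rcases ih (Quot.eqvGen_sound ‹_›) with rfl | ih
      · exact Or.inl rfl
      · right
        have hxy : v x = v y := by simpa using v.map_add_eq_of_lt_left ih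
        rwa [v.map_sub_swap, hxy]
    | trans x y z _ _ ih₁ ih₂ =>
      rcases ih₁ (Quot.eqvGen_sound ‹_›) with rfl | ih₁
      · exact ih₂ (Quot.eqvGen_sound ‹_›)
      rcases ih₂ (Quot.eqvGen_sound ‹_›) with rfl | ih₂
      · exact Or.inr ih₁
      right
      have hyz : v y = v z := by simpa using v.map_add_eq_of_lt_left ih₂
      rw [hyz] at ih₁
      simpa using v.map_add_lt ih₁ ih₂
  · rintro (rfl | h)
    · rfl
    · have hy : y ≠ 0 := by
        rintro rfl
        simp at h
      refine (Quot.sound (show rvRel v 1 y x from Or.inr ⟨x / y, ?_, by field_simp⟩)).symm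
      rw [show x / y - 1 = (x - y) / y by field_simp, map_div₀]
      exact (div_lt_one₀ (v.pos_iff.mpr hy)).mpr h

theorem rv_eq_rv_zero_iff (v : Valuation K Γ₀) (x : K) : rv v 1 x = rv v 1 0 ↔ x = 0 := by
  simp [rv_eq_rv_iff]

theorem rv_sub_eq_rv_sub_iff (v : Valuation K Γ₀) {x c : K} (hx : x ≠ c) (y : K) :
    rv v 1 (y - c) = rv v 1 (x - c) ↔ v (y - x) < v (x - c) := by
  rw [rv_eq_rv_iff, sub_sub_sub_cancel_right, sub_left_inj, or_iff_right_iff_imp]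
  rintro rfl
  simpa [zero_lt_iff] using sub_ne_zero.mpr hx

theorem rv_fiber_eq (v : Valuation K Γ₀) {C : Finset K} {x : K} (hx : x ∉ C) :
    {y : K | ∀ c ∈ C, rv v 1 (y - c) = rv v 1 (x - c)} =
      {y : K | ∀ c ∈ C, v (y - x) < v (x - c)} := by
  ext y
  exact forall₂_congr fun c hc => rv_sub_eq_rv_sub_iff v (ne_of_mem_of_not_mem hc hx).symm y

theorem rv_fiber_infinite (v : Valuation K Γ₀) (hv : ∃ a : K, v a ≠ 0 ∧ v a ≠ 1)
    {C : Finset K} (hC : C.Nonempty) {x : K} (hx : x ∉ C) :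
    {y : K | ∀ c ∈ C, v (y - x) < v (x - c)}.Infinite := by
  obtain ⟨a, ha₀, ha₁⟩ : ∃ a : K, 0 < v a ∧ v a < 1 := by
    obtain ⟨a, ha₀, ha₁⟩ := hv
    rcases lt_or_gt_of_ne ha₁ with h | h
    · exact ⟨a, zero_lt_iff.mpr ha₀, h⟩
    · refine ⟨a⁻¹, ?_, ?_⟩
      · simpa [zero_lt_iff] using ha₀
      · rw [map_inv₀]
        exact inv_lt_one_of_one_lt₀ h
  obtain ⟨c₀, hc₀, hmin⟩ := C.exists_min_image (fun c => v (x - c)) hC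
  have hxc : x - c₀ ≠ 0 := sub_ne_zero.mpr fun h => hx (h ▸ hc₀)
  refine Set.infinite_of_injective_forall_mem (f := fun n : ℕ => x + (x - c₀) * a ^ (n + 1)) ?_ ?_
  · intro m n hmn
    have h : v (a ^ (m + 1)) = v (a ^ (n + 1)) :=
      congrArg v (mul_left_cancel₀ hxc (add_left_cancel hmn))
    rw [map_pow, map_pow] at h
    exact Nat.succ_injective ((pow_right_strictAnti₀ ha₀ ha₁).injective h)
  · intro n c hc
    refine lt_of_lt_of_le ?_ (hmin c hc)
    rw [add_sub_cancel_left, map_mul, map_pow]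
    exact mul_lt_of_lt_one_right (v.pos_iff.mpr hxc) (pow_lt_one₀ zero_le ha₁ n.succ_ne_zero)

theorem rv_fiber_isBall (v : Valuation K Γ₀) (hv : ∃ a : K, v a ≠ 0 ∧ v a ≠ 1)
    {C : Finset K} (hC : C.Nonempty) {x : K} (hx : x ∉ C) :
    IsBall v {y : K | ∀ c ∈ C, v (y - x) < v (x - c)} := by
  refine ⟨rv_fiber_infinite v hv hC hx, ?_, ?_⟩
  · obtain ⟨c, hc⟩ := hC
    refine Set.ne_univ_iff_exists_notMem _ |>.mpr ⟨c, fun h => ?_⟩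
    exact (h c hc).ne (v.map_sub_swap c x)
  · intro y hy z hz w hw c hc
    have hyz : v (y - z) < v (x - c) := by
      rw [← sub_sub_sub_cancel_right y z x]
      exact (v.map_sub _ _).trans_lt (max_lt (hy c hc) (hz c hc))
    rw [show w - x = y - x - (y - w) by ring]
    exact (v.map_sub _ _).trans_lt (max_lt (hy c hc) (hw.trans_lt hyz))

/-- For a nontrivially valued field `K` and a finite nonempty `C ⊆ K`, the fibers of
`x ↦ (rv(x − c))_{c ∈ C}` are exactly the singletons `{c}` for `c ∈ C` and the balls
1-next to `C` (nonempty intersections `⋂_{c ∈ C} {x : rv(x − c) = ξ_c}` with all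
`ξ_c ≠ 0`); these fibers partition `K`, and the fibers disjoint from `C` are exactly
the maximal balls of `K` disjoint from `C`. -/
theorem rv_fibers_around_finite_set (v : Valuation K Γ₀)
    (hv : ∃ a : K, v a ≠ 0 ∧ v a ≠ 1) (C : Finset K) (hC : C.Nonempty) :
    -- fibers through points of `C` are the singletons `{c}`, `c ∈ C`
    (∀ x ∈ C, {y : K | ∀ c ∈ C, rv v 1 (y - c) = rv v 1 (x - c)} = {x}) ∧
    -- a fiber through a point outside `C` is a ball 1-next to `C`
    (∀ x : K, x ∉ C →
      ∃ ξ : K → Quot (rvRel v 1), (∀ c ∈ C, ξ c ≠ rv v 1 0) ∧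
        {y : K | ∀ c ∈ C, rv v 1 (y - c) = rv v 1 (x - c)} =
          ⋂ c ∈ C, {y : K | rv v 1 (y - c) = ξ c}) ∧
    -- every ball 1-next to `C` is such a fiber
    (∀ ξ : K → Quot (rvRel v 1), (∀ c ∈ C, ξ c ≠ rv v 1 0) →
      (⋂ c ∈ C, {y : K | rv v 1 (y - c) = ξ c}).Nonempty →
      ∃ x : K, x ∉ C ∧ (⋂ c ∈ C, {y : K | rv v 1 (y - c) = ξ c}) =
        {y : K | ∀ c ∈ C, rv v 1 (y - c) = rv v 1 (x - c)}) ∧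
    -- the fibers partition `K`
    (∀ x : K, x ∈ {y : K | ∀ c ∈ C, rv v 1 (y - c) = rv v 1 (x - c)}) ∧
    (∀ x x' : K,
      {y : K | ∀ c ∈ C, rv v 1 (y - c) = rv v 1 (x - c)} =
        {y : K | ∀ c ∈ C, rv v 1 (y - c) = rv v 1 (x' - c)} ∨
      Disjoint {y : K | ∀ c ∈ C, rv v 1 (y - c) = rv v 1 (x - c)}
        {y : K | ∀ c ∈ C, rv v 1 (y - c) = rv v 1 (x' - c)}) ∧
    -- fibers disjoint from `C` = maximal balls disjoint from `C`
    (∀ B : Set K,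
      (∃ x : K, x ∉ C ∧ B = {y : K | ∀ c ∈ C, rv v 1 (y - c) = rv v 1 (x - c)}) ↔
      (IsBall v B ∧ (∀ c ∈ C, c ∉ B) ∧
        ∀ B' : Set K, IsBall v B' → B ⊂ B' → ∃ c ∈ C, c ∈ B')) := by
  have hfiber {x : K} (hx : x ∉ C) := rv_fiber_eq v hx
  refine ⟨?_, ?_, ?_, fun x c _ => rfl, ?_, ?_⟩
  · intro x hx
    refine Set.eq_singleton_iff_unique_mem.mpr ⟨fun _ _ => rfl, fun y hy => ?_⟩
    have h := hy x hx
    rwa [sub_self, rv_eq_rv_zero_iff, sub_eq_zero] at h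
  · intro x hx
    refine ⟨fun c => rv v 1 (x - c), fun c hc => ?_, by ext; simp⟩
    rw [Ne, rv_eq_rv_zero_iff, sub_eq_zero]
    exact fun h => hx (h ▸ hc)
  · rintro ξ hξ ⟨x, hx⟩
    simp only [Set.mem_iInter, Set.mem_ofPred_eq] at hx
    refine ⟨x, fun hxC => hξ x hxC ?_, ?_⟩
    · rw [← hx x hxC, sub_self]
    · ext y
      simp only [Set.mem_iInter, Set.mem_ofPred_eq]
      exact forall₂_congr fun c hc => by rw [hx c hc]
  · intro x x'
    refine or_iff_not_imp_right.mpr fun h => ?_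
    obtain ⟨z, hz, hz'⟩ := Set.not_disjoint_iff.mp h
    ext y
    exact forall₂_congr fun c hc => by rw [← hz c hc, ← hz' c hc]
  · intro B
    constructor
    · rintro ⟨x, hx, rfl⟩
      rw [hfiber hx]
      refine ⟨rv_fiber_isBall v hv hC hx, ?_, ?_⟩
      · exact fun c hc h => (h c hc).ne (v.map_sub_swap c x)
      · intro B' hB' hlt
        obtain ⟨hsub, z, hz, hzn⟩ := Set.ssubset_iff_exists.mp hlt
        simp only [Set.mem_ofPred_eq, not_forall, not_lt] at hzn
        obtain ⟨c, hc, hle⟩ := hzn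
        have hxB' : x ∈ B' := hsub ((hfiber hx).subset fun _ _ => rfl)
        exact ⟨c, hc, hB'.2.2 x hxB' z hz c (by rwa [v.map_sub_swap x z])⟩
    · rintro ⟨hB, hBC, hmax⟩
      obtain ⟨x, hxB⟩ := hB.1.nonempty
      have hx : x ∉ C := fun h => hBC x h hxB
      refine ⟨x, hx, ?_⟩
      rw [hfiber hx]
      have hsub : B ⊆ {y : K | ∀ c ∈ C, v (y - x) < v (x - c)} := by
        intro y hy c hc
        by_contra! hle
        exact hBC c hc (hB.2.2 x hxB y hy c (by rwa [v.map_sub_swap x y]))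
      by_contra hne
      obtain ⟨c, hc, hcF⟩ := hmax _ (rv_fiber_isBall v hv hC hx) (hsub.ssubset_of_ne hne)
      exact (hcF c hc).ne (v.map_sub_swap c x)
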